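/- Let k ≥ 2, let f : (Fin m → Bool) → Bool and g : (Fin n → Bool) → Bool, and define h over the m + n + (k−1) variables (α, β, x₁, …, x_{k−1}) by: h(α, β, x) = true iff at least k of the k + 1 values f α, g β, x₁, …, x_{k−1} are true. Then h has a frozen variable if and only if exactly one of f and g is satisfiable. -/

import Mathlib

theorem card_filter_true_le {r : ℕ} (x : Fin r → Bool) :
    (Finset.univ.filter (fun j => x j = true)).card ≤ r := by
  simpa using Finset.card_filter_le (Finset.univ : Finset (Fin r)) (fun j => x j = true)

theorem eq_true_of_le_card_filter_true {r : ℕ} (x : Fin r → Bool)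
    (hx : r ≤ (Finset.univ.filter (fun j => x j = true)).card) (j : Fin r) : x j = true := by
  have hcard : (Finset.univ.filter (fun j => x j = true)).card =
      (Finset.univ : Finset (Fin r)).card := by
    simpa using le_antisymm (card_filter_true_le x) hx
  exact Finset.card_filter_eq_iff.mp hcard j (Finset.mem_univ j)

theorem le_card_filter_update_true_add_one {r : ℕ} (j : Fin r) (b : Bool) :
    r ≤ (Finset.univ.filter
      (fun i => Function.update (fun _ => true) j b i = true)).card + 1 := by
  have hsub : Finset.univ.erase j ⊆ Finset.univ.filter
      (fun i => Function.update (fun _ => true) j b i = true) := by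
    intro i hi
    simp [Function.update_of_ne (Finset.ne_of_mem_erase hi)]
  have hle := Finset.card_le_card hsub
  rw [Finset.card_erase_of_mem (Finset.mem_univ j), Finset.card_univ, Fintype.card_fin] at hle
  omega

/-- For `k ≥ 2`, the function `h(α,β,x) = true` iff at least `k` of
the `k+1` values `f α, g β, x₁, …, x_{k-1}` are true, has a frozen variable iff
exactly one of `f` and `g` is satisfiable. -/
theorem stmt_16 (k m n : ℕ) (hk : 2 ≤ k)
    (f : (Fin m → Bool) → Bool) (g : (Fin n → Bool) → Bool)
    (h : ((Fin m ⊕ Fin n) ⊕ Fin (k - 1) → Bool) → Bool)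
    (hh : ∀ J : (Fin m ⊕ Fin n) ⊕ Fin (k - 1) → Bool,
      h J = decide (k ≤
        (if f (fun i => J (Sum.inl (Sum.inl i))) then 1 else 0) +
        (if g (fun i => J (Sum.inl (Sum.inr i))) then 1 else 0) +
        (Finset.univ.filter (fun j : Fin (k - 1) => J (Sum.inr j) = true)).card)) :
    (∃ v : (Fin m ⊕ Fin n) ⊕ Fin (k - 1),
        (∃ J, h J = true) ∧ ∃ c : Bool, ∀ J, h J = true → J v = c) ↔
    (((∃ α, f α = true) ∧ ¬(∃ β, g β = true)) ∨
      (¬(∃ α, f α = true) ∧ (∃ β, g β = true))) := by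
  have h_elim : ∀ α β x, h (Sum.elim (Sum.elim α β) x) = true ↔
      k ≤ (if f α then 1 else 0) + (if g β then 1 else 0) +
        (Finset.univ.filter (fun j => x j = true)).card := by
    intro α β x
    rw [hh]
    exact decide_eq_true_iff
  constructor
  · rintro ⟨v, ⟨J, hJ⟩, c, hc⟩
    have hsat : (∃ α, f α = true) ∨ ∃ β, g β = true := by
      by_contra! hunsat
      have hle := card_filter_true_le (fun j => J (Sum.inr j))
      simp [hh, hunsat.1, hunsat.2] at hJ
      omega
    have hnot : ¬((∃ α, f α = true) ∧ ∃ β, g β = true) := by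
      rintro ⟨⟨α, hα⟩, β, hβ⟩
      rcases v with (i | i) | j
      · have := hc (Sum.elim (Sum.elim (fun _ => !c) β) (fun _ => true))
          ((h_elim _ _ _).2 (by simp [hβ]; omega))
        simp at this
      · have := hc (Sum.elim (Sum.elim α (fun _ => !c)) (fun _ => true))
          ((h_elim _ _ _).2 (by simp [hα]; omega))
        simp at this
      · have hle := le_card_filter_update_true_add_one j (!c)
        have := hc (Sum.elim (Sum.elim α β) (Function.update (fun _ => true) j (!c)))
          ((h_elim _ _ _).2 (by rw [if_pos hα, if_pos hβ]; omega))
        simp at this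
    tauto
  · intro hone
    refine ⟨Sum.inr ⟨0, by omega⟩, ?_, true, fun J hJ => ?_⟩
    · rcases hone with ⟨⟨α, hα⟩, -⟩ | ⟨-, β, hβ⟩
      · exact ⟨Sum.elim (Sum.elim α (fun _ => true)) (fun _ => true),
          (h_elim _ _ _).2 (by simp [hα]; omega)⟩
      · exact ⟨Sum.elim (Sum.elim (fun _ => true) β) (fun _ => true),
          (h_elim _ _ _).2 (by simp [hβ]; omega)⟩
    · refine eq_true_of_le_card_filter_true (fun j => J (Sum.inr j)) ?_ _
      rw [hh, decide_eq_true_iff] at hJ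
      rcases hone with ⟨-, hg⟩ | ⟨hf, -⟩
      · rw [if_neg (fun e => hg ⟨_, e⟩)] at hJ
        split_ifs at hJ <;> omega
      · rw [if_neg (fun e => hf ⟨_, e⟩)] at hJ
        split_ifs at hJ <;> omega
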